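/- arXiv:2101.08407 — 6 statements merged into one kernel-verified Lean document; each statement's English description precedes it below -/
import Mathlib

section
/- Let X₁,…,X_N and Y be Banach spaces over 𝕂 = ℝ or ℂ, and let 𝕋 denote the unit sphere of 𝕂. Let A ∈ L^N(X₁,…,X_N;Y) be such that M_A = {(θ¹x₀¹,…,θᴺx₀ᴺ) : (θ¹,…,θᴺ) ∈ 𝕋^N} for some fixed (x₀¹,…,x₀ᴺ) ∈ S_{X₁}×⋯×S_{X_N}. Suppose that sup_{(x¹,…,xᴺ)∈D} ‖A(x¹,…,xᴺ)‖ < ‖A‖ whenever D is a closed subset of S_{X₁}×⋯×S_{X_N} with dist(M_A,D) > 0. Then for any B ∈ L^N(X₁,…,X_N;Y), A ⊥_B B if and only if A(x₀¹,…,x₀ᴺ) ⊥_B B(x₀¹,…,x₀ᴺ). -/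
noncomputable section

/-- `x` is Birkhoff--James orthogonal to `y`: `‖x‖ ≤ ‖x + a • y‖` for every scalar `a`. -/
def BJOrth (𝕂 : Type*) [RCLike 𝕂] {E : Type*} [NormedAddCommGroup E] [NormedSpace 𝕂 E]
    (x y : E) : Prop :=
  ∀ a : 𝕂, ‖x‖ ≤ ‖x + a • y‖

/-- Unimodular rotations of the arguments do not change the norm of a multilinear map. -/
theorem ContinuousMultilinearMap.norm_map_smul_of_norm_eq_one {𝕂 ι : Type*} [RCLike 𝕂]
    [Fintype ι] {X : ι → Type*} [∀ i, NormedAddCommGroup (X i)] [∀ i, NormedSpace 𝕂 (X i)]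
    {Y : Type*} [NormedAddCommGroup Y] [NormedSpace 𝕂 Y]
    (C : ContinuousMultilinearMap 𝕂 X Y) (θ : ι → 𝕂) (hθ : ∀ i, ‖θ i‖ = 1) (z : ∀ i, X i) :
    ‖C (fun i => θ i • z i)‖ = ‖C z‖ := by
  rw [C.map_smul_univ, norm_smul, norm_prod]
  simp [hθ]

/-- The norm of a multilinear map is controlled by its values on the product of unit spheres. -/
theorem ContinuousMultilinearMap.opNorm_le_of_unit_sphere {𝕂 ι : Type*} [RCLike 𝕂]
    [Fintype ι] {X : ι → Type*} [∀ i, NormedAddCommGroup (X i)] [∀ i, NormedSpace 𝕂 (X i)]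
    {Y : Type*} [NormedAddCommGroup Y] [NormedSpace 𝕂 Y]
    (C : ContinuousMultilinearMap 𝕂 X Y) {M : ℝ} (hM : 0 ≤ M)
    (h : ∀ z : ∀ i, X i, (∀ i, ‖z i‖ = 1) → ‖C z‖ ≤ M) : ‖C‖ ≤ M := by
  refine C.opNorm_le_bound hM fun m => ?_
  by_cases hm : ∃ i, m i = 0
  · obtain ⟨i, hi⟩ := hm
    rw [C.map_coord_zero i hi, norm_zero]
    positivity
  · push Not at hm
    have hu : ∀ i, ‖((‖m i‖ : 𝕂)⁻¹) • m i‖ = 1 := fun i => norm_smul_inv_norm (hm i)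
    have hm' : m = fun i => (‖m i‖ : 𝕂) • (((‖m i‖ : 𝕂)⁻¹) • m i) := by
      funext i
      rw [smul_inv_smul₀]
      simpa using hm i
    calc ‖C m‖ = (∏ i, ‖m i‖) * ‖C fun i => ((‖m i‖ : 𝕂)⁻¹) • m i‖ := by
          conv_lhs => rw [hm', C.map_smul_univ, norm_smul, norm_prod]
          simp
      _ ≤ (∏ i, ‖m i‖) * M := by
          gcongr
          exact h _ hu
      _ = M * ∏ i, ‖m i‖ := mul_comm _ _

/-- If `M_A` is exactly the set of rotations of a single point `x₀` of the product of unit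
spheres, and `‖A‖` is not approached away from `M_A`, then `A ⊥_B B` iff `A x₀ ⊥_B B x₀`. -/
theorem BJOrth_iff_of_single_norm_attaining_point {𝕂 : Type*} [RCLike 𝕂] {N : ℕ}
    {X : Fin N → Type*}
    [∀ i, NormedAddCommGroup (X i)] [∀ i, NormedSpace 𝕂 (X i)] [∀ i, CompleteSpace (X i)]
    {Y : Type*} [NormedAddCommGroup Y] [NormedSpace 𝕂 Y] [CompleteSpace Y]
    (A : ContinuousMultilinearMap 𝕂 X Y) (x₀ : ∀ i, X i)
    (hx₀ : ∀ i, ‖x₀ i‖ = 1)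
    (hMA : ∀ z : ∀ i, X i,
      ((∀ i, ‖z i‖ = 1) ∧ ‖A z‖ = ‖A‖) ↔
        ∃ θ : ∀ i, 𝕂, (∀ i, ‖θ i‖ = 1) ∧ z = fun i => θ i • x₀ i)
    (hsup : ∀ D : Set (∀ i, X i), IsClosed D → (∀ z ∈ D, ∀ i, ‖z i‖ = 1) →
      (∃ r : ℝ, 0 < r ∧ ∀ z : ∀ i, X i, ((∀ i, ‖z i‖ = 1) ∧ ‖A z‖ = ‖A‖) →
        ∀ w ∈ D, r ≤ dist z w) →
      (⨆ w ∈ D, ‖A w‖) < ‖A‖)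
    (B : ContinuousMultilinearMap 𝕂 X Y) :
    BJOrth 𝕂 A B ↔ BJOrth 𝕂 (A x₀) (B x₀) := by
  have hAx₀ : ‖A x₀‖ = ‖A‖ :=
    ((hMA x₀).2 ⟨fun _ => 1, fun _ => norm_one, by simp⟩).2
  have unit_le : ∀ (C : ContinuousMultilinearMap 𝕂 X Y) (z : ∀ i, X i),
      (∀ i, ‖z i‖ = 1) → ‖C z‖ ≤ ‖C‖ := fun C z hz => by
    simpa [hz] using C.le_opNorm z
  refine ⟨fun h a => ?_, fun h a => ?_⟩
  · by_contra! hlt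
    rw [hAx₀] at hlt
    obtain ⟨c, hc, hcA⟩ := exists_between hlt
    obtain ⟨r, hr, hball⟩ : ∃ r > 0, ∀ z, dist z x₀ < r → ‖(A + a • B) z‖ < c :=
      Metric.eventually_nhds_iff.1
        ((A + a • B).cont.norm.continuousAt.eventually_lt_const hc)
    let U : Set (∀ i, X i) :=
      ⋃ θ ∈ {θ : Fin N → 𝕂 | ∀ i, ‖θ i‖ = 1}, Metric.ball (fun i => θ i • x₀ i) r
    have hU : ∀ z ∈ U, ‖(A + a • B) z‖ < c := by
      intro z hz
      simp only [U, Set.mem_iUnion, Set.mem_ofPred_eq, Metric.mem_ball] at hz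
      obtain ⟨θ, hθ, hz⟩ := hz
      have hθ' : ∀ i, ‖(θ i)⁻¹‖ = 1 := fun i => by simp [hθ i]
      rw [← (A + a • B).norm_map_smul_of_norm_eq_one _ hθ']
      refine hball _ ((dist_pi_lt_iff hr).2 fun i => ?_)
      have hne : θ i ≠ 0 := norm_ne_zero_iff.1 (by simp [hθ i])
      have := (dist_pi_lt_iff hr).1 hz i
      calc dist ((θ i)⁻¹ • z i) (x₀ i)
          = dist ((θ i)⁻¹ • z i) ((θ i)⁻¹ • (θ i • x₀ i)) := by rw [inv_smul_smul₀ hne]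
        _ = dist (z i) (θ i • x₀ i) := by rw [dist_smul₀, hθ' i, one_mul]
        _ < r := this
    let D : Set (∀ i, X i) := {z | ∀ i, ‖z i‖ = 1} \ U
    have hD : IsClosed D := by
      refine IsClosed.sdiff ?_ (isOpen_biUnion fun _ _ => Metric.isOpen_ball)
      simp only [Set.ofPred_forall]
      exact isClosed_iInter fun i =>
        isClosed_eq (continuous_apply i).norm continuous_const
    have hs := hsup D hD (fun z hz => hz.1) ⟨r, hr, fun z hz w hw => by
      obtain ⟨θ, hθ, rfl⟩ := (hMA z).1 hz
      by_contra! hlt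
      rw [dist_comm] at hlt
      exact hw.2 (Set.mem_biUnion hθ hlt)⟩
    let s := ⨆ w ∈ D, ‖A w‖
    have hDs : ∀ w ∈ D, ‖A w‖ ≤ s := by
      intro w hw
      have hb : BddAbove (Set.range fun w => ⨆ _ : w ∈ D, ‖A w‖) := by
        refine ⟨‖A‖, ?_⟩
        rintro _ ⟨w, rfl⟩
        exact Real.iSup_le (fun hw => unit_le A w hw.1) (norm_nonneg _)
      refine le_trans ?_ (le_ciSup hb w)
      simp [hw]
    have hs0 : 0 ≤ s := Real.iSup_nonneg fun w => Real.iSup_nonneg fun _ => norm_nonneg _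
    have hk : 0 ≤ ‖a • B‖ := norm_nonneg _
    obtain ⟨t, ht0, ht1, htk⟩ : ∃ t : ℝ, 0 < t ∧ t ≤ 1 ∧ t * ‖a • B‖ < ‖A‖ - s := by
      refine ⟨min 1 ((‖A‖ - s) / (‖a • B‖ + 1)), ?_, min_le_left _ _, ?_⟩
      · have : 0 < ‖A‖ - s := sub_pos.2 hs
        positivity
      · calc _ ≤ (‖A‖ - s) / (‖a • B‖ + 1) * ‖a • B‖ := by gcongr; exact min_le_right _ _
          _ < ‖A‖ - s := by
            rw [div_mul_eq_mul_div, div_lt_iff₀ (by positivity)]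
            nlinarith
    have hnt : ‖(t : 𝕂)‖ = t := by simp [abs_of_pos ht0]
    have hn1t : ‖((1 - t : ℝ) : 𝕂)‖ = 1 - t := by
      rw [RCLike.norm_ofReal, abs_of_nonneg (by linarith)]
    have key : ‖A + ((t : 𝕂) * a) • B‖ ≤
        max (s + t * ‖a • B‖) ((1 - t) * ‖A‖ + t * c) := by
      refine ContinuousMultilinearMap.opNorm_le_of_unit_sphere _
        (le_max_of_le_left (by positivity)) fun z hz => ?_
      by_cases hzU : z ∈ U
      · refine le_max_of_le_right ?_
        have hconv : (A + ((t : 𝕂) * a) • B) z =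
            ((1 - t : ℝ) : 𝕂) • A z + (t : 𝕂) • (A + a • B) z := by
          simp only [add_apply, smul_apply]
          push_cast
          module
        calc _ ≤ (1 - t) * ‖A z‖ + t * ‖(A + a • B) z‖ := by
              rw [hconv]
              refine (norm_add_le _ _).trans_eq ?_
              rw [norm_smul, norm_smul, hnt, hn1t]
          _ ≤ (1 - t) * ‖A‖ + t * c := by
              have h1t : 0 ≤ 1 - t := by linarith
              gcongr
              · exact unit_le A z hz
              · exact (hU z hzU).le
      · refine le_max_of_le_left ?_
        calc _ = ‖A z + (t : 𝕂) • (a • B) z‖ := by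
              simp [mul_smul]
          _ ≤ ‖A z‖ + t * ‖(a • B) z‖ := by
              refine (norm_add_le _ _).trans_eq ?_
              rw [norm_smul, hnt]
          _ ≤ s + t * ‖a • B‖ := by
              gcongr
              · exact hDs z ⟨hz, hzU⟩
              · exact unit_le (a • B) z hz
    refine absurd ((h _).trans key) (not_le.2 (max_lt (by linarith) ?_))
    nlinarith
  · calc ‖A‖ = ‖A x₀‖ := hAx₀.symm
      _ ≤ ‖A x₀ + a • B x₀‖ := h a
      _ = ‖(A + a • B) x₀‖ := rfl
      _ ≤ ‖A + a • B‖ := unit_le _ x₀ hx₀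
end
end

section
/- Let Y be a Banach space over 𝕂 = ℝ or ℂ and let T ∈ L(c₀;Y) be a norm attaining operator. If there is a finite set A ⊂ ℕ such that ‖T∘P_A‖ = ‖T‖ and ‖T∘(I − P_A)‖ < ‖T‖, then T does not have the Bhatia–Šemrl property. -/
noncomputable section

/-- The Bhatia--Šemrl property for bounded linear operators: whenever `T ⊥_B S` there is a
norm attaining point `x` of `T` with `T x ⊥_B S x`. -/
def HasBSProp (𝕂 : Type*) [RCLike 𝕂] {X Y : Type*} [NormedAddCommGroup X] [NormedSpace 𝕂 X]
    [NormedAddCommGroup Y] [NormedSpace 𝕂 Y] (T : X →L[𝕂] Y) : Prop :=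
  ∀ S : X →L[𝕂] Y, BJOrth 𝕂 T S →
    ∃ x : X, ‖x‖ = 1 ∧ ‖T x‖ = ‖T‖ ∧ BJOrth 𝕂 (T x) (S x)

open scoped ZeroAtInfty

/-- The element of `c₀` obtained from `f` by keeping the coordinates in the finite set `A`
and setting the others to `0`. -/
def projFun {𝕂 : Type*} [RCLike 𝕂] (A : Finset ℕ) (f : C₀(ℕ, 𝕂)) : C₀(ℕ, 𝕂) where
  toFun n := if n ∈ A then f n else 0
  continuous_toFun := continuous_of_discreteTopology
  zero_at_infty' := by
    rw [Filter.cocompact_eq_cofinite]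
    refine Filter.Tendsto.congr' ?_ tendsto_const_nhds
    have h : {n : ℕ | ¬ (0 : 𝕂) = if n ∈ A then f n else 0}.Finite := by
      apply (A : Set ℕ).toFinite.subset
      intro n hn
      simp only [Set.mem_setOf_eq] at hn
      by_contra hA
      rw [Finset.mem_coe] at hA
      exact hn (by rw [if_neg hA])
    exact Filter.eventually_cofinite.mpr h

lemma projFun_norm_le {𝕂 : Type*} [RCLike 𝕂] (A : Finset ℕ) (f : C₀(ℕ, 𝕂)) :
    ‖projFun A f‖ ≤ ‖f‖ := by
  rw [← ZeroAtInftyContinuousMap.norm_toBCF_eq_norm, ← ZeroAtInftyContinuousMap.norm_toBCF_eq_norm]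
  refine (BoundedContinuousFunction.norm_le (norm_nonneg _)).mpr fun n => ?_
  show ‖if n ∈ A then f n else 0‖ ≤ _
  split
  · exact BoundedContinuousFunction.norm_coe_le_norm f.toBCF n
  · simp

/-- The canonical projection `P_A : c₀ → c₀` onto the coordinates in a finite set `A ⊆ ℕ`. -/
def projC0 (𝕂 : Type*) [RCLike 𝕂] (A : Finset ℕ) : C₀(ℕ, 𝕂) →L[𝕂] C₀(ℕ, 𝕂) :=
  LinearMap.mkContinuous
    { toFun := projFun A
      map_add' := fun f g => by
        ext n
        show (if n ∈ A then (f + g) n else 0)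
          = (if n ∈ A then f n else 0) + (if n ∈ A then g n else 0)
        split <;> simp
      map_smul' := fun c f => by
        ext n
        show (if n ∈ A then (c • f) n else 0) = c • (if n ∈ A then f n else 0)
        split <;> simp }
    1 (fun f => by simpa using projFun_norm_le A f)

namespace ZeroAtInftyContinuousMap

variable {𝕂 : Type*} [RCLike 𝕂]

lemma norm_apply_le_norm (f : C₀(ℕ, 𝕂)) (n : ℕ) : ‖f n‖ ≤ ‖f‖ := by
  rw [← norm_toBCF_eq_norm]
  exact BoundedContinuousFunction.norm_coe_le_norm f.toBCF n

lemma norm_le_of_forall_norm_apply_le {f : C₀(ℕ, 𝕂)} {C : ℝ} (hC : 0 ≤ C)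
    (h : ∀ n, ‖f n‖ ≤ C) : ‖f‖ ≤ C := by
  rw [← norm_toBCF_eq_norm]
  exact (BoundedContinuousFunction.norm_le hC).mpr h

lemma exists_forall_norm_apply_lt (f : C₀(ℕ, 𝕂)) {ε : ℝ} (hε : 0 < ε) :
    ∃ N, ∀ n, N ≤ n → ‖f n‖ < ε := by
  have h := f.zero_at_infty'
  rw [Filter.cocompact_eq_cofinite, Nat.cofinite_eq_atTop] at h
  obtain ⟨N, hN⟩ := Metric.tendsto_atTop.mp h ε hε
  exact ⟨N, fun n hn => by simpa using hN n hn⟩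

lemma exists_eq_ite_mem (s : Finset ℕ) (h : ℕ → 𝕂) :
    ∃ z : C₀(ℕ, 𝕂), ∀ n, z n = if n ∈ s then h n else 0 := by
  refine ⟨⟨⟨fun n => if n ∈ s then h n else 0, continuous_of_discreteTopology⟩, ?_⟩,
    fun n => rfl⟩
  rw [Filter.cocompact_eq_cofinite]
  refine tendsto_const_nhds.congr' (Filter.eventually_cofinite.mpr ?_)
  refine s.finite_toSet.subset fun n hn => ?_
  by_contra hs
  exact hn (if_neg hs).symm

/-- A functional attaining its norm at `x` vanishes on the sequences supported where `x` stays
away from modulus one. -/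
lemma apply_eq_zero_of_norm_attaining (f : C₀(ℕ, 𝕂) →L[𝕂] 𝕂) {M : ℝ}
    (hf : ∀ v, ‖f v‖ ≤ M * ‖v‖) {x : C₀(ℕ, 𝕂)} (hx : ‖x‖ = 1) (hfx : f x = (M : 𝕂))
    {N : ℕ} (hN : ∀ n, N ≤ n → ‖x n‖ < 1 / 2) {z : C₀(ℕ, 𝕂)} (hz : ∀ n, n < N → z n = 0) :
    f z = 0 := by
  have hM : 0 ≤ M := by simpa [hx] using (norm_nonneg _).trans (hf x)
  by_contra hw
  have hw' : 0 < ‖f z‖ := norm_pos_iff.mpr hw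
  set t : ℝ := 1 / (2 * (‖f z‖ * (‖z‖ + 1))) with ht
  have hz1 : 0 < ‖z‖ + 1 := by positivity
  have ht0 : 0 < t := by positivity
  set c : 𝕂 := (t : 𝕂) * (starRingEnd 𝕂) (f z) with hc
  have hcn : ‖c‖ * (‖z‖ + 1) = 1 / 2 := by
    rw [hc, norm_mul, RCLike.norm_ofReal, abs_of_pos ht0, RCLike.norm_conj, ht]
    field_simp
  have hball : ‖x + c • z‖ ≤ 1 := by
    refine norm_le_of_forall_norm_apply_le zero_le_one fun n => ?_
    show ‖x n + c • z n‖ ≤ 1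
    rcases lt_or_ge n N with hn | hn
    · simpa [hz n hn, hx] using norm_apply_le_norm x n
    · have h3 : ‖c‖ * ‖z n‖ ≤ ‖c‖ * (‖z‖ + 1) :=
        mul_le_mul_of_nonneg_left (by linarith [norm_apply_le_norm z n]) (norm_nonneg _)
      have h4 := norm_add_le (x n) (c • z n)
      rw [norm_smul] at h4
      linarith [hN n hn]
  have hval : f (x + c • z) = ((M + t * ‖f z‖ ^ 2 : ℝ) : 𝕂) := by
    rw [map_add, map_smul, hfx, smul_eq_mul, hc, mul_assoc, RCLike.conj_mul]
    push_cast
    ring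
  have h5 := (hf (x + c • z)).trans (mul_le_of_le_one_right hM hball)
  rw [hval, RCLike.norm_ofReal, abs_of_nonneg (by positivity)] at h5
  have : 0 < t * ‖f z‖ ^ 2 := by positivity
  linarith

lemma summable_geometric_mul_apply (N : ℕ) (x : C₀(ℕ, 𝕂)) :
    Summable fun k : ℕ => ‖((1 / 2 / 2 ^ k : ℝ) : 𝕂) * x (N + k)‖ := by
  refine Summable.of_nonneg_of_le (fun _ => norm_nonneg _) (fun k => ?_)
    ((summable_geometric_two' 1).mul_right ‖x‖)
  rw [norm_mul, RCLike.norm_ofReal, abs_of_nonneg (by positivity)]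
  exact mul_le_mul_of_nonneg_left (norm_apply_le_norm _ _) (by positivity)

lemma norm_tsum_geometric_mul_apply_le (N : ℕ) (x : C₀(ℕ, 𝕂)) :
    ‖∑' k : ℕ, ((1 / 2 / 2 ^ k : ℝ) : 𝕂) * x (N + k)‖ ≤ 1 * ‖x‖ := by
  refine (norm_tsum_le_tsum_norm (summable_geometric_mul_apply N x)).trans ?_
  rw [show (1 : ℝ) * ‖x‖ = ∑' k : ℕ, 1 / 2 / 2 ^ k * ‖x‖ by
    rw [tsum_mul_right, tsum_geometric_two']]
  refine (summable_geometric_mul_apply N x).tsum_le_tsum (fun k => ?_)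
    ((summable_geometric_two' 1).mul_right ‖x‖)
  rw [norm_mul, RCLike.norm_ofReal, abs_of_nonneg (by positivity)]
  exact mul_le_mul_of_nonneg_left (norm_apply_le_norm _ _) (by positivity)

/-- The functional `x ↦ ∑ k, 2 ^ (-(k + 1)) * x (N + k)` on `c₀`. -/
def geometricFunctional (𝕂 : Type*) [RCLike 𝕂] (N : ℕ) : C₀(ℕ, 𝕂) →L[𝕂] 𝕂 :=
  LinearMap.mkContinuous
    { toFun := fun x => ∑' k : ℕ, ((1 / 2 / 2 ^ k : ℝ) : 𝕂) * x (N + k)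
      map_add' := fun x y => by
        rw [← (summable_geometric_mul_apply N x).of_norm.tsum_add
          (summable_geometric_mul_apply N y).of_norm]
        exact tsum_congr fun k => mul_add _ _ _
      map_smul' := fun c x => by
        rw [RingHom.id_apply, smul_eq_mul, ← tsum_mul_left]
        exact tsum_congr fun k => mul_left_comm _ _ _ }
    1 (norm_tsum_geometric_mul_apply_le N)

lemma geometricFunctional_apply (N : ℕ) (x : C₀(ℕ, 𝕂)) :
    geometricFunctional 𝕂 N x = ∑' k : ℕ, ((1 / 2 / 2 ^ k : ℝ) : 𝕂) * x (N + k) := rfl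

/-- The functional `geometricFunctional 𝕂 N` has norm one and does not attain it. -/
lemma norm_geometricFunctional_apply_lt (N : ℕ) {x : C₀(ℕ, 𝕂)} (hx : ‖x‖ = 1) :
    ‖geometricFunctional 𝕂 N x‖ < 1 := by
  rw [geometricFunctional_apply]
  refine (norm_tsum_le_tsum_norm (summable_geometric_mul_apply N x)).trans_lt ?_
  conv_rhs => rw [← tsum_geometric_two' 1]
  obtain ⟨K, hK⟩ := exists_forall_norm_apply_lt x one_pos
  refine Summable.tsum_lt_tsum (i := K) (fun k => ?_) ?_ (summable_geometric_mul_apply N x)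
    (summable_geometric_two' 1)
  · rw [norm_mul, RCLike.norm_ofReal, abs_of_nonneg (by positivity)]
    exact mul_le_of_le_one_right (by positivity) (hx ▸ norm_apply_le_norm x _)
  · rw [norm_mul, RCLike.norm_ofReal, abs_of_nonneg (by positivity)]
    exact mul_lt_of_lt_one_right (by positivity) (hK _ (by omega))

lemma geometricFunctional_apply_eq (N m : ℕ) {x : C₀(ℕ, 𝕂)}
    (h1 : ∀ k, k < m → x (N + k) = 1) (h0 : ∀ k, m ≤ k → x (N + k) = 0) :
    geometricFunctional 𝕂 N x = ((1 - (1 / 2) ^ m : ℝ) : 𝕂) := by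
  rw [geometricFunctional_apply, tsum_eq_sum (s := Finset.range m)
    fun k hk => by rw [h0 k (by simpa using hk), mul_zero],
    Finset.sum_congr rfl fun k hk => by rw [h1 k (Finset.mem_range.mp hk), mul_one],
    ← RCLike.ofReal_sum]
  congr 1
  clear h1 h0
  induction m with
  | zero => simp
  | succ m ih =>
    rw [Finset.sum_range_succ, ih, one_div_pow, one_div_pow]
    field_simp
    ring

end ZeroAtInftyContinuousMap

open ZeroAtInftyContinuousMap in
/-- No nonzero norm attaining operator on `c₀` has the Bhatia--Šemrl property. -/
lemma not_hasBSProp_of_norm_attaining {𝕂 Y : Type*} [RCLike 𝕂]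
    [NormedAddCommGroup Y] [NormedSpace 𝕂 Y] (T : C₀(ℕ, 𝕂) →L[𝕂] Y)
    (hNA : ∃ x : C₀(ℕ, 𝕂), ‖x‖ = 1 ∧ ‖T x‖ = ‖T‖) (hT : 0 < ‖T‖) : ¬ HasBSProp 𝕂 T := by
  obtain ⟨x, hx, hTx⟩ := hNA
  obtain ⟨φ, hφ, hφx⟩ := exists_dual_vector 𝕂 (T x) (hTx ▸ hT.ne')
  rw [hTx] at hφx
  obtain ⟨N, hN⟩ := exists_forall_norm_apply_lt x (ε := 1 / 2) (by norm_num)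
  have hφle : ∀ y, ‖φ y‖ ≤ ‖y‖ := fun y => by simpa [hφ] using φ.le_opNorm y
  have hvanish : ∀ z : C₀(ℕ, 𝕂), (∀ n, n < N → z n = 0) → φ (T z) = 0 := fun z hz =>
    apply_eq_zero_of_norm_attaining (φ.comp T)
      (fun v => (hφle _).trans (T.le_opNorm v)) hx hφx hN hz
  obtain ⟨u, hu⟩ := exists_eq_ite_mem (Finset.range N) x
  have hφu : φ (T u) = (‖T‖ : 𝕂) := by
    have h := hvanish (x - u) fun n hn => by
      show x n - u n = 0
      rw [hu, if_pos (Finset.mem_range.mpr hn), sub_self]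
    rw [map_sub, map_sub, hφx, sub_eq_zero] at h
    exact h.symm
  have hu1 : ‖u‖ ≤ 1 := norm_le_of_forall_norm_apply_le zero_le_one fun n => by
    rw [hu]
    split
    · exact hx ▸ norm_apply_le_norm x n
    · simp
  set g := geometricFunctional 𝕂 N
  intro hBS
  obtain ⟨w, hw, hTw, hw'⟩ := hBS (T - g.smulRight (T u)) fun a => by
    have key : ∀ m : ℕ, ‖((‖T‖ : 𝕂)) * (1 + a * (((1 / 2) ^ m : ℝ) : 𝕂))‖
        ≤ ‖T + a • (T - g.smulRight (T u))‖ := fun m => by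
      obtain ⟨z, hz⟩ := exists_eq_ite_mem (Finset.Ico N (N + m)) (fun _ => (1 : 𝕂))
      have hφz : φ (T z) = 0 := hvanish z fun n hn => by
        rw [hz, if_neg (by simp; omega)]
      have hgv : g (u + z) = ((1 - (1 / 2) ^ m : ℝ) : 𝕂) := by
        refine geometricFunctional_apply_eq N m (fun k hk => ?_) fun k hk => ?_
        · show u _ + z _ = 1
          rw [hu, hz, if_neg (by simp), if_pos (by simp [hk]), zero_add]
        · show u _ + z _ = 0
          rw [hu, hz, if_neg (by simp), if_neg (by simp; omega), zero_add]
      have hv1 : ‖u + z‖ ≤ 1 := norm_le_of_forall_norm_apply_le zero_le_one fun n => by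
        show ‖u n + z n‖ ≤ 1
        rcases lt_or_ge n N with hn | hn
        · rw [hz, if_neg (by simp; omega), add_zero]
          exact (norm_apply_le_norm u n).trans hu1
        · rw [hu, hz, if_neg (by simpa using hn), zero_add]
          split <;> simp
      have hval : φ ((T + a • (T - g.smulRight (T u))) (u + z))
          = (‖T‖ : 𝕂) * (1 + a * (((1 / 2) ^ m : ℝ) : 𝕂)) := by
        simp only [_root_.add_apply, _root_.smul_apply,
          _root_.sub_apply, ContinuousLinearMap.smulRight_apply, hgv]
        simp only [map_add, map_smul, map_sub, hφu, hφz, smul_eq_mul]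
        push_cast
        ring
      rw [← hval]
      exact (hφle _).trans (ContinuousLinearMap.unit_le_opNorm _ _ hv1)
    have hpow : Filter.Tendsto (fun m : ℕ => (((1 / 2) ^ m : ℝ) : 𝕂)) Filter.atTop (nhds 0) := by
      exact ((RCLike.continuous_ofReal (K := 𝕂)).tendsto' 0 0 (by simp)).comp
        (tendsto_pow_atTop_nhds_zero_of_lt_one (r := (1 / 2 : ℝ)) (by norm_num) (by norm_num))
    have hlim := (((hpow.const_mul a).const_add 1).const_mul (‖T‖ : 𝕂)).norm
    rw [mul_zero, add_zero, mul_one, RCLike.norm_ofReal, abs_of_pos hT] at hlim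
    exact le_of_tendsto' hlim key
  have h := hw' (-1)
  have heq : T w + (-1 : 𝕂) • (T - g.smulRight (T u)) w = g w • T u := by
    simp
  rw [heq, norm_smul, hTw] at h
  have hTu : ‖T u‖ ≤ ‖T‖ := T.unit_le_opNorm u hu1
  have hgw : ‖g w‖ < 1 := norm_geometricFunctional_apply_lt N hw
  nlinarith [norm_nonneg (g w), mul_le_mul_of_nonneg_left hTu (norm_nonneg (g w))]

/-- If a norm attaining operator `T : c₀ → Y` satisfies `‖T ∘ P_A‖ = ‖T‖` and
`‖T ∘ (I - P_A)‖ < ‖T‖` for some finite `A ⊆ ℕ`, then `T` fails the Bhatia--Šemrl property. -/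
theorem not_BS_of_proj_norm_eq {𝕂 Y : Type*} [RCLike 𝕂]
    [NormedAddCommGroup Y] [NormedSpace 𝕂 Y] [CompleteSpace Y]
    (T : C₀(ℕ, 𝕂) →L[𝕂] Y)
    (hNA : ∃ x : C₀(ℕ, 𝕂), ‖x‖ = 1 ∧ ‖T x‖ = ‖T‖)
    (A : Finset ℕ)
    (h1 : ‖T.comp (projC0 𝕂 A)‖ = ‖T‖)
    (h2 : ‖T.comp (ContinuousLinearMap.id 𝕂 C₀(ℕ, 𝕂) - projC0 𝕂 A)‖ < ‖T‖) :
    ¬ HasBSProp 𝕂 T := by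
  exact not_hasBSProp_of_norm_attaining T hNA ((ContinuousLinearMap.opNorm_nonneg _).trans_lt h2)
end
end

section
/- Let Y be a Banach space over 𝕂 = ℝ or ℂ and let T ∈ L(c₀;Y) be a norm attaining operator. Then there exists a finite set A ⊂ ℕ such that ‖T∘P_A‖ = ‖T‖. -/
noncomputable section

open scoped ZeroAtInfty

lemma ZeroAtInftyContinuousMap.norm_le_of_forall_le {𝕂 : Type*} [RCLike 𝕂] {f : C₀(ℕ, 𝕂)} {C : ℝ}
    (hC : 0 ≤ C) (h : ∀ n, ‖f n‖ ≤ C) : ‖f‖ ≤ C := by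
  rw [← ZeroAtInftyContinuousMap.norm_toBCF_eq_norm]
  exact (BoundedContinuousFunction.norm_le hC).mpr h

lemma ZeroAtInftyContinuousMap.norm_apply_le {𝕂 : Type*} [RCLike 𝕂] (f : C₀(ℕ, 𝕂)) (n : ℕ) :
    ‖f n‖ ≤ ‖f‖ := by
  rw [← ZeroAtInftyContinuousMap.norm_toBCF_eq_norm]
  exact BoundedContinuousFunction.norm_coe_le_norm f.toBCF n

lemma ZeroAtInftyContinuousMap.exists_finset_norm_apply_lt {𝕂 : Type*} [RCLike 𝕂]
    (f : C₀(ℕ, 𝕂)) {ε : ℝ} (hε : 0 < ε) : ∃ A : Finset ℕ, ∀ n ∉ A, ‖f n‖ < ε := by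
  have hf := f.zero_at_infty'.norm
  rw [Filter.cocompact_eq_cofinite, norm_zero] at hf
  have hfin := Filter.eventually_cofinite.mp (hf.eventually_lt_const hε)
  refine ⟨hfin.toFinset, fun n hn => ?_⟩
  by_contra h
  exact hn (hfin.mem_toFinset.mpr h)

lemma projC0_apply {𝕂 : Type*} [RCLike 𝕂] (A : Finset ℕ) (f : C₀(ℕ, 𝕂)) (n : ℕ) :
    projC0 𝕂 A f n = if n ∈ A then f n else 0 := rfl

lemma norm_projC0_apply_le {𝕂 : Type*} [RCLike 𝕂] (A : Finset ℕ) (f : C₀(ℕ, 𝕂)) :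
    ‖projC0 𝕂 A f‖ ≤ ‖f‖ :=
  projFun_norm_le A f

/-- Doubling the coordinates outside `A` of a vector of the unit ball stays in the unit ball if the coordinates outside `A` are at most `1 / 2`. -/
lemma norm_add_sub_projC0_le_one {𝕂 : Type*} [RCLike 𝕂] {A : Finset ℕ} {x : C₀(ℕ, 𝕂)}
    (hx : ‖x‖ ≤ 1) (hA : ∀ n ∉ A, ‖x n‖ ≤ 1 / 2) : ‖x + (x - projC0 𝕂 A x)‖ ≤ 1 := by
  refine ZeroAtInftyContinuousMap.norm_le_of_forall_le zero_le_one fun n => ?_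
  rw [ZeroAtInftyContinuousMap.add_apply, ZeroAtInftyContinuousMap.sub_apply, projC0_apply]
  split_ifs with hn
  · simpa using (x.norm_apply_le n).trans hx
  · rw [sub_zero]
    linarith [norm_add_le (x n) (x n), hA n hn]

/-- Every norm attaining operator `T : c₀ → Y` satisfies `‖T ∘ P_A‖ = ‖T‖` for some finite
set `A ⊆ ℕ`. -/
theorem exists_finset_norm_comp_proj_eq {𝕂 Y : Type*} [RCLike 𝕂]
    [NormedAddCommGroup Y] [NormedSpace 𝕂 Y] [CompleteSpace Y]
    (T : C₀(ℕ, 𝕂) →L[𝕂] Y)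
    (hNA : ∃ x : C₀(ℕ, 𝕂), ‖x‖ = 1 ∧ ‖T x‖ = ‖T‖) :
    ∃ A : Finset ℕ, ‖T.comp (projC0 𝕂 A)‖ = ‖T‖ := by
  obtain ⟨x, hx, hTx⟩ := hNA
  obtain ⟨A, hA⟩ := x.exists_finset_norm_apply_lt (ε := 1 / 2) (by norm_num)
  have hP (f : C₀(ℕ, 𝕂)) : ‖projC0 𝕂 A f‖ ≤ ‖f‖ := norm_projC0_apply_le A f
  refine ⟨A, le_antisymm ?_ ?_⟩
  · exact ContinuousLinearMap.opNorm_le_bound _ T.opNorm_nonneg fun f =>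
      T.le_opNorm_of_le (hP f)
  · have hdouble : ‖T (x + (x - projC0 𝕂 A x))‖ ≤ ‖T‖ :=
      T.unit_le_opNorm _ (norm_add_sub_projC0_le_one hx.le fun n hn => (hA n hn).le)
    have hproj : ‖T (projC0 𝕂 A x)‖ ≤ ‖T.comp (projC0 𝕂 A)‖ :=
      (T.comp (projC0 𝕂 A)).unit_le_opNorm x hx.le
    have hsum : T (x + (x - projC0 𝕂 A x)) + T (projC0 𝕂 A x) = (2 : 𝕂) • T x := by
      rw [two_smul, ← map_add, ← map_add]
      congr 1
      abel
    have hnorm := norm_add_le (T (x + (x - projC0 𝕂 A x))) (T (projC0 𝕂 A x))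
    rw [hsum, norm_smul, RCLike.norm_ofNat, hTx] at hnorm
    linarith
end
end

section
/- Let X₂,…,X_N and Y be nontrivial Banach spaces over 𝕂 = ℝ or ℂ. Then BS(c₀,X₂,…,X_N;Y) is not dense in L^N(c₀,X₂,…,X_N;Y). -/
noncomputable section

/-- The Bhatia--Šemrl property for bounded `N`-linear maps: whenever `A ⊥_B B` there is a
point of the product of unit spheres at which `A` attains its norm and
`A x ⊥_B B x`. -/
def HasBSPropMulti (𝕂 : Type*) [RCLike 𝕂] {N : ℕ} {X : Fin N → Type*}
    [∀ i, NormedAddCommGroup (X i)] [∀ i, NormedSpace 𝕂 (X i)]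
    {Y : Type*} [NormedAddCommGroup Y] [NormedSpace 𝕂 Y]
    (A : ContinuousMultilinearMap 𝕂 X Y) : Prop :=
  ∀ B : ContinuousMultilinearMap 𝕂 X Y, BJOrth 𝕂 A B →
    ∃ x : ∀ i, X i, (∀ i, ‖x i‖ = 1) ∧ ‖A x‖ = ‖A‖ ∧ BJOrth 𝕂 (A x) (B x)

open scoped ZeroAtInfty

universe u v

/-- The family of spaces `(c₀, X 0, …, X (N-1))`. -/
abbrev C0Cons (𝕂 : Type u) [RCLike 𝕂] {N : ℕ} (X : Fin N → Type u) : Fin (N + 1) → Type u :=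
  Fin.cons (α := fun _ => Type u) C₀(ℕ, 𝕂) X

variable {𝕂 : Type u} [RCLike 𝕂] {N : ℕ} {X : Fin N → Type u}
  [∀ i, NormedAddCommGroup (X i)] [∀ i, NormedSpace 𝕂 (X i)]

instance (i : Fin (N + 1)) : NormedAddCommGroup (C0Cons 𝕂 X i) :=
  Fin.cases (motive := fun i => NormedAddCommGroup (C0Cons 𝕂 X i))
    (inferInstanceAs (NormedAddCommGroup C₀(ℕ, 𝕂)))
    (fun j => inferInstanceAs (NormedAddCommGroup (X j))) i

instance (i : Fin (N + 1)) : NormedSpace 𝕂 (C0Cons 𝕂 X i) :=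
  Fin.cases (motive := fun i => NormedSpace 𝕂 (C0Cons 𝕂 X i))
    (inferInstanceAs (NormedSpace 𝕂 C₀(ℕ, 𝕂)))
    (fun j => inferInstanceAs (NormedSpace 𝕂 (X j))) i

/-- The element of `c₀` given by an eventually vanishing sequence. -/
def c0OfEventuallyZero (𝕜 : Type*) [RCLike 𝕜] (f : ℕ → 𝕜) (k : ℕ) (hf : ∀ n, k ≤ n → f n = 0) :
    C₀(ℕ, 𝕜) where
  toFun := f
  continuous_toFun := continuous_of_discreteTopology
  zero_at_infty' := by
    rw [Filter.cocompact_eq_cofinite, Nat.cofinite_eq_atTop]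
    refine tendsto_const_nhds.congr' ?_
    filter_upwards [Filter.eventually_ge_atTop k] with n hn using (hf n hn).symm

lemma c0_norm_apply_le {𝕜 : Type*} [RCLike 𝕜] (z : C₀(ℕ, 𝕜)) (n : ℕ) : ‖z n‖ ≤ ‖z‖ := by
  rw [← ZeroAtInftyContinuousMap.norm_toBCF_eq_norm]
  exact z.toBCF.norm_coe_le_norm n

lemma c0_norm_le {𝕜 : Type*} [RCLike 𝕜] {z : C₀(ℕ, 𝕜)} {c : ℝ} (hc : 0 ≤ c)
    (h : ∀ n, ‖z n‖ ≤ c) : ‖z‖ ≤ c := by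
  rw [← ZeroAtInftyContinuousMap.norm_toBCF_eq_norm]
  exact (BoundedContinuousFunction.norm_le hc).2 h

lemma c0_eventually_norm_le_half {𝕜 : Type*} [RCLike 𝕜] (z : C₀(ℕ, 𝕜)) :
    ∃ m, ∀ n, m ≤ n → ‖z n‖ ≤ 1 / 2 := by
  have h := z.zero_at_infty'
  rw [Filter.cocompact_eq_cofinite, Nat.cofinite_eq_atTop] at h
  have h' := h.norm
  rw [norm_zero] at h'
  exact Filter.eventually_atTop.1 (h'.eventually_le_const (by norm_num))

lemma c0_exists_tail_functional (𝕜 : Type*) [RCLike 𝕜] (m : ℕ) :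
    ∃ γ : C₀(ℕ, 𝕜) →L[𝕜] 𝕜, (∀ z, ‖z‖ ≤ 1 → ‖γ z‖ < 1) ∧
      ∀ z, γ z = ∑' n, ((1 / 2 / 2 ^ n : ℝ) : 𝕜) * z (m + n) := by
  have hw : HasSum (fun n : ℕ => (1 / 2 / 2 ^ n : ℝ)) 1 := hasSum_geometric_two' 1
  have hle : ∀ (z : C₀(ℕ, 𝕜)) (n : ℕ),
      ‖((1 / 2 / 2 ^ n : ℝ) : 𝕜) * z (m + n)‖ ≤ (1 / 2 / 2 ^ n : ℝ) * ‖z‖ := by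
    intro z n
    rw [norm_mul, RCLike.norm_of_nonneg (by positivity)]
    gcongr
    exact c0_norm_apply_le z _
  have hsn : ∀ z : C₀(ℕ, 𝕜), Summable fun n => ‖((1 / 2 / 2 ^ n : ℝ) : 𝕜) * z (m + n)‖ :=
    fun z => Summable.of_nonneg_of_le (fun _ => norm_nonneg _) (hle z) (hw.summable.mul_right _)
  have hs : ∀ z : C₀(ℕ, 𝕜), Summable fun n => ((1 / 2 / 2 ^ n : ℝ) : 𝕜) * z (m + n) :=
    fun z => (hsn z).of_norm
  let L : C₀(ℕ, 𝕜) →ₗ[𝕜] 𝕜 :=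
    { toFun := fun z => ∑' n, ((1 / 2 / 2 ^ n : ℝ) : 𝕜) * z (m + n)
      map_add' := fun z w => by
        rw [← (hs z).tsum_add (hs w)]
        simp only [ZeroAtInftyContinuousMap.add_apply, mul_add]
      map_smul' := fun c z => by
        simp only [ZeroAtInftyContinuousMap.smul_apply, smul_eq_mul, RingHom.id_apply]
        rw [← tsum_mul_left]
        simp only [mul_left_comm] }
  refine ⟨L.mkContinuous 1 fun z => ?_, fun z hz => ?_, fun z => rfl⟩
  · refine (tsum_of_norm_bounded (hw.mul_right ‖z‖) (hle z))
  · obtain ⟨j, hj⟩ := c0_eventually_norm_le_half z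
    have hle1 : ∀ n, ‖((1 / 2 / 2 ^ n : ℝ) : 𝕜) * z (m + n)‖ ≤ (1 / 2 / 2 ^ n : ℝ) := fun n =>
      (hle z n).trans (mul_le_of_le_one_right (by positivity) hz)
    have hlt : ‖((1 / 2 / 2 ^ j : ℝ) : 𝕜) * z (m + j)‖ < (1 / 2 / 2 ^ j : ℝ) := by
      rw [norm_mul, RCLike.norm_of_nonneg (by positivity)]
      exact mul_lt_of_lt_one_right (by positivity)
        ((hj (m + j) (Nat.le_add_left _ _)).trans_lt (by norm_num))
    calc ‖∑' n, ((1 / 2 / 2 ^ n : ℝ) : 𝕜) * z (m + n)‖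
        ≤ ∑' n, ‖((1 / 2 / 2 ^ n : ℝ) : 𝕜) * z (m + n)‖ := norm_tsum_le_tsum_norm (hsn z)
      _ < ∑' n : ℕ, (1 / 2 / 2 ^ n : ℝ) := Summable.tsum_lt_tsum hle1 hlt (hsn z) hw.summable
      _ = 1 := hw.tsum_eq

/-- Every `x` in the unit ball admits a functional of norm at most one which does not attain one
on the ball, but is nearly one at points `u` of the ball such that `x` is interior to a segment of
the ball in the direction `u - x`. -/
def HasNonattainingDirections (𝕜 : Type*) [RCLike 𝕜] (E : Type*) [NormedAddCommGroup E]
    [NormedSpace 𝕜 E] : Prop :=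
  ∀ x : E, ‖x‖ ≤ 1 → ∃ γ : E →L[𝕜] 𝕜, (∀ z, ‖z‖ ≤ 1 → ‖γ z‖ < 1) ∧
    ∀ ε : ℝ, 0 < ε → ∃ u : E, ‖u‖ ≤ 1 ∧ ‖1 - γ u‖ < ε ∧
      ∃ t : 𝕜, t ≠ 0 ∧ ‖x + t • (u - x)‖ ≤ 1 ∧ ‖x - t • (u - x)‖ ≤ 1

lemma c0_hasNonattainingDirections (𝕜 : Type*) [RCLike 𝕜] :
    HasNonattainingDirections 𝕜 C₀(ℕ, 𝕜) := by
  intro x hx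
  obtain ⟨m, hm⟩ := c0_eventually_norm_le_half x
  obtain ⟨γ, hγ, hγt⟩ := c0_exists_tail_functional 𝕜 m
  refine ⟨γ, hγ, fun ε hε => ?_⟩
  have hw : HasSum (fun n : ℕ => ((1 / 2 / 2 ^ n : ℝ) : 𝕜)) ((1 : ℝ) : 𝕜) :=
    (RCLike.hasSum_ofReal 𝕜).2 (hasSum_geometric_two' 1)
  rw [RCLike.ofReal_one] at hw
  obtain ⟨k, hk⟩ := (Metric.tendsto_atTop.1 hw.tendsto_sum_nat ε hε)
  have hk := hk k le_rfl
  have hx1 : ∀ n, ‖x n‖ ≤ 1 := fun n => (c0_norm_apply_le x n).trans hx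
  let u : C₀(ℕ, 𝕜) := c0OfEventuallyZero 𝕜
    (fun n => if n < m then x n else if n < m + k then 1 else 0) (m + k)
    (fun n hn => by rw [if_neg (by omega), if_neg (by omega)])
  have hu : ∀ n, u n = if n < m then x n else if n < m + k then 1 else 0 := fun n => rfl
  have hu1 : ∀ n, ‖u n‖ ≤ 1 := by
    intro n
    rw [hu]
    split_ifs
    · exact hx1 n
    · simp
    · simp
  have hγu : γ u = ∑ n ∈ Finset.range k, ((1 / 2 / 2 ^ n : ℝ) : 𝕜) := by
    rw [hγt, tsum_eq_sum (s := Finset.range k)]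
    · refine Finset.sum_congr rfl fun n hn => ?_
      have := Finset.mem_range.1 hn
      rw [hu, if_neg (by omega), if_pos (by omega), mul_one]
    · intro n hn
      rw [Finset.mem_range] at hn
      rw [hu, if_neg (by omega), if_neg (by omega), mul_zero]
  have hv : ∀ n, ‖x n‖ + ‖((1 / 4 : ℝ) : 𝕜) * (u n - x n)‖ ≤ 1 := by
    intro n
    rw [norm_mul, RCLike.norm_of_nonneg (by norm_num)]
    by_cases hn : n < m
    · rw [hu, if_pos hn, sub_self, norm_zero]
      linarith [hx1 n]
    · have h1 := hm n (by omega)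
      have h2 := norm_sub_le (u n) (x n)
      have h3 := hu1 n
      linarith
  refine ⟨u, c0_norm_le zero_le_one hu1, ?_, ((1 / 4 : ℝ) : 𝕜), ?_, ?_, ?_⟩
  · rw [hγu, ← dist_eq_norm, dist_comm]
    exact hk
  · exact RCLike.ofReal_ne_zero.2 (by norm_num)
  · exact c0_norm_le zero_le_one fun n => (norm_add_le _ _).trans (hv n)
  · exact c0_norm_le zero_le_one fun n => (norm_sub_le _ _).trans (hv n)

lemma eq_zero_of_norm_add_le_of_norm_sub_le {𝕜 : Type*} [RCLike 𝕜] {M : ℝ} {c : 𝕜}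
    (h₁ : ‖(M : 𝕜) + c‖ ≤ M) (h₂ : ‖(M : 𝕜) - c‖ ≤ M) : c = 0 := by
  have hM : 0 ≤ M := (norm_nonneg _).trans h₁
  have h := parallelogram_law_with_norm 𝕜 (M : 𝕜) c
  rw [RCLike.norm_of_nonneg hM] at h
  have : ‖c‖ = 0 := by
    nlinarith [norm_nonneg c, norm_nonneg ((M : 𝕜) + c), norm_nonneg ((M : 𝕜) - c)]
  exact norm_eq_zero.1 this

/-- The multilinear map `z ↦ (∏ i, f i (z i)) • y`. -/
def prodSMulRight {𝕜 : Type*} [RCLike 𝕜] {ι : Type*} [Fintype ι] {E : ι → Type*}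
    [∀ i, NormedAddCommGroup (E i)] [∀ i, NormedSpace 𝕜 (E i)]
    {Y : Type*} [NormedAddCommGroup Y] [NormedSpace 𝕜 Y] (f : ∀ i, E i →L[𝕜] 𝕜) (y : Y) :
    ContinuousMultilinearMap 𝕜 E Y :=
  ((ContinuousMultilinearMap.mkPiAlgebra 𝕜 ι 𝕜).compContinuousLinearMap f).smulRight y

lemma prodSMulRight_apply {𝕜 : Type*} [RCLike 𝕜] {ι : Type*} [Fintype ι] {E : ι → Type*}
    [∀ i, NormedAddCommGroup (E i)] [∀ i, NormedSpace 𝕜 (E i)]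
    {Y : Type*} [NormedAddCommGroup Y] [NormedSpace 𝕜 Y] (f : ∀ i, E i →L[𝕜] 𝕜) (y : Y)
    (z : ∀ i, E i) : prodSMulRight f y z = (∏ i, f i (z i)) • y := by
  simp [prodSMulRight]

lemma exists_continuousMultilinearMap_ne_zero {𝕜 : Type*} [RCLike 𝕜] {ι : Type*} [Fintype ι]
    {E : ι → Type*} [∀ i, NormedAddCommGroup (E i)] [∀ i, NormedSpace 𝕜 (E i)]
    {Y : Type*} [NormedAddCommGroup Y] [NormedSpace 𝕜 Y] [Nontrivial Y]
    (hE : ∀ i, ∃ x : E i, x ≠ 0) : ∃ A : ContinuousMultilinearMap 𝕜 E Y, A ≠ 0 := by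
  choose x hx using hE
  choose f _ hfx using fun i => exists_dual_vector 𝕜 (x i) (norm_ne_zero_iff.2 (hx i))
  obtain ⟨y, hy⟩ := exists_ne (0 : Y)
  refine ⟨prodSMulRight f y, fun h => ?_⟩
  have h0 : prodSMulRight f y x = 0 := by rw [h]; rfl
  rw [prodSMulRight_apply, smul_eq_zero, or_iff_left hy, Finset.prod_eq_zero_iff] at h0
  obtain ⟨i, -, hi⟩ := h0
  rw [hfx, RCLike.ofReal_eq_zero, norm_eq_zero] at hi
  exact hx i hi

lemma norm_le_of_forall_norm_le_one {𝕜 : Type*} [RCLike 𝕜] {ι : Type*} [Fintype ι]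
    {E : ι → Type*} [∀ i, NormedAddCommGroup (E i)] [∀ i, NormedSpace 𝕜 (E i)]
    {Y : Type*} [NormedAddCommGroup Y] [NormedSpace 𝕜 Y] (A : ContinuousMultilinearMap 𝕜 E Y)
    {z : ∀ i, E i} (hz : ∀ i, ‖z i‖ ≤ 1) : ‖A z‖ ≤ ‖A‖ :=
  (A.le_opNorm z).trans
    (mul_le_of_le_one_right (norm_nonneg _)
      (Finset.prod_le_one (fun _ _ => norm_nonneg _) fun i _ => hz i))

/-- If one factor has nonattaining directions, only the zero map has the
Bhatia–Šemrl property. -/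
lemma HasBSPropMulti.eq_zero {𝕜 : Type*} [RCLike 𝕜] {n : ℕ} {E : Fin n → Type*}
    [∀ i, NormedAddCommGroup (E i)] [∀ i, NormedSpace 𝕜 (E i)]
    {Y : Type*} [NormedAddCommGroup Y] [NormedSpace 𝕜 Y] (i₀ : Fin n)
    (hE : HasNonattainingDirections 𝕜 (E i₀)) {A : ContinuousMultilinearMap 𝕜 E Y}
    (hA : HasBSPropMulti 𝕜 A) : A = 0 := by
  by_contra hA0
  have hM : 0 < ‖A‖ := norm_pos_iff.2 hA0
  obtain ⟨x, hx, hAx, -⟩ := hA 0 fun a => by simp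
  obtain ⟨γ, hγ, hγx⟩ := hE (x i₀) (hx i₀).le
  obtain ⟨g, hg, hgx⟩ := exists_dual_vector 𝕜 (A x) (hAx ▸ hM.ne')
  rw [hAx] at hgx
  choose f hf hfx using fun i => exists_dual_vector 𝕜 (x i) (by rw [hx i]; exact one_ne_zero)
  have hgA : ∀ (D : ContinuousMultilinearMap 𝕜 E Y) (z : E i₀), ‖z‖ ≤ 1 →
      ‖g (D (Function.update x i₀ z))‖ ≤ ‖D‖ := by
    intro D z hz
    refine (g.le_opNorm _).trans ?_
    rw [hg, one_mul]
    refine norm_le_of_forall_norm_le_one D fun i => ?_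
    rcases eq_or_ne i i₀ with rfl | hi
    · simpa using hz
    · simpa [hi] using (hx i).le
  let C : ContinuousMultilinearMap 𝕜 E Y := prodSMulRight (Function.update f i₀ γ) (A x)
  have hCu : ∀ u, C (Function.update x i₀ u) = γ u • A x := by
    intro u
    rw [prodSMulRight_apply, Finset.prod_eq_single i₀]
    · simp
    · intro i _ hi
      simp [hi, hfx, hx]
    · simp
  have hCz : ∀ z : ∀ i, E i, (∀ i, ‖z i‖ = 1) → ‖C z‖ < ‖A‖ := by
    intro z hz
    rw [prodSMulRight_apply, norm_smul, hAx, norm_prod]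
    refine mul_lt_of_lt_one_left hM ?_
    rw [← Finset.mul_prod_erase _ _ (Finset.mem_univ i₀), Function.update_self]
    refine (mul_le_of_le_one_right (norm_nonneg _)
      (Finset.prod_le_one (fun _ _ => norm_nonneg _) fun i hi => ?_)).trans_lt
        (hγ _ (hz i₀).le)
    rw [Function.update_of_ne (Finset.ne_of_mem_erase hi)]
    simpa [hf, hz] using (f i).le_opNorm (z i)
  have hgu : ∀ (u : E i₀) (t : 𝕜), t ≠ 0 → ‖x i₀ + t • (u - x i₀)‖ ≤ 1 →
      ‖x i₀ - t • (u - x i₀)‖ ≤ 1 → g (A (Function.update x i₀ u)) = ‖A‖ := by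
    intro u t ht h₁ h₂
    have k₁ := hgA A _ h₁
    have k₂ := hgA A _ h₂
    rw [A.map_update_add, A.map_update_smul, Function.update_eq_self, map_add, map_smul, hgx]
      at k₁
    rw [A.map_update_sub, A.map_update_smul, Function.update_eq_self, map_sub, map_smul, hgx]
      at k₂
    have h0 := eq_zero_of_norm_add_le_of_norm_sub_le k₁ k₂
    rw [smul_eq_zero, or_iff_right ht, A.map_update_sub, map_sub, Function.update_eq_self,
      hgx, sub_eq_zero] at h0
    exact h0
  have horth : BJOrth 𝕜 A (A - C) := by
    intro a
    refine le_of_forall_pos_sub_le fun δ hδ => ?_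
    obtain ⟨u, hu, huε, t, ht, h₁, h₂⟩ :=
      hγx (δ / (‖a‖ * ‖A‖ + 1)) (by positivity)
    have key := hgA (A + a • (A - C)) u hu
    have hval : g ((A + a • (A - C)) (Function.update x i₀ u))
        = (‖A‖ : 𝕜) + a * (1 - γ u) * (‖A‖ : 𝕜) := by
      simp only [add_apply, smul_apply,
        sub_apply, hCu, map_add, map_smul, map_sub, hgx,
        hgu u t ht h₁ h₂, smul_eq_mul]
      ring
    rw [hval] at key
    have hlow := norm_sub_le_norm_add (‖A‖ : 𝕜) (a * (1 - γ u) * (‖A‖ : 𝕜))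
    rw [norm_mul, norm_mul, RCLike.norm_of_nonneg hM.le] at hlow
    have hsmall : ‖a‖ * ‖1 - γ u‖ * ‖A‖ ≤ δ := by
      rw [lt_div_iff₀ (by positivity)] at huε
      nlinarith [norm_nonneg (1 - γ u)]
    linarith
  obtain ⟨z, hz, hAz, hzo⟩ := hA _ horth
  have h := hzo (-((1 / 2 : ℝ) : 𝕜))
  have hmid : A z + (-((1 / 2 : ℝ) : 𝕜)) • (A - C) z
      = ((1 / 2 : ℝ) : 𝕜) • A z + ((1 / 2 : ℝ) : 𝕜) • C z := by
    have h2 : (1 : 𝕜) = ((1 / 2 : ℝ) : 𝕜) + ((1 / 2 : ℝ) : 𝕜) := by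
      rw [← RCLike.ofReal_add]; norm_num
    rw [sub_apply]
    nth_rewrite 1 [← one_smul 𝕜 (A z)]
    rw [h2]
    module
  rw [hmid] at h
  have h' := h.trans (norm_add_le _ _)
  rw [norm_smul, norm_smul, RCLike.norm_of_nonneg (by norm_num)] at h'
  linarith [hCz z hz]

/-- For nontrivial Banach spaces `X 0, …, X (N-1)` and `Y`, the multilinear maps on
`c₀ × X 0 × ⋯ × X (N-1)` with the Bhatia--Šemrl property are not dense. -/
theorem BS_not_dense_multilinear_c0
    [∀ i, CompleteSpace (X i)] [∀ i, Nontrivial (X i)]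
    {Y : Type v} [NormedAddCommGroup Y] [NormedSpace 𝕂 Y] [CompleteSpace Y] [Nontrivial Y] :
    ¬ Dense {A : ContinuousMultilinearMap 𝕂 (C0Cons 𝕂 X) Y | HasBSPropMulti 𝕂 A} := by
  intro hd
  have hE : ∀ i : Fin (N + 1), ∃ x : C0Cons 𝕂 X i, x ≠ 0 := by
    refine Fin.cases ?_ fun j => ?_
    · let e : C₀(ℕ, 𝕂) := c0OfEventuallyZero 𝕂 (fun n => if n = 0 then 1 else 0) 1
        fun n hn => if_neg (by omega)
      refine ⟨e, fun h => ?_⟩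
      have h0 : e 0 = 0 := congrArg (fun z : C₀(ℕ, 𝕂) => z 0) h
      exact one_ne_zero h0
    · exact exists_ne (0 : X j)
  obtain ⟨A, hA⟩ := exists_continuousMultilinearMap_ne_zero (𝕜 := 𝕂) (Y := Y) hE
  obtain ⟨B, hB0, hB⟩ := hd.inter_open_nonempty {0}ᶜ isOpen_compl_singleton ⟨A, hA⟩
  exact hB0 (HasBSPropMulti.eq_zero 0 (c0_hasNonattainingDirections 𝕂) hB)
end
end

section
/- Let X₁,…,X_N and Y be Banach spaces over 𝕂 = ℝ or ℂ. If an N-linear map A ∈ L^N(X₁,…,X_N;Y) has the Bhatia–Šemrl property, then the associated operator T_A ∈ L(X₁; L^{N−1}(X₂,…,X_N;Y)), defined by (T_A x₁)(x₂,…,x_N) = A(x₁,…,x_N), has the Bhatia–Šemrl property. -/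
noncomputable section

/-- The value of `f` at a tuple of unit vectors is bounded in norm by `‖f‖`. -/
theorem ContinuousMultilinearMap.norm_apply_le_of_norm_eq_one {𝕂 : Type*} [RCLike 𝕂] {N : ℕ}
    {X : Fin N → Type*} [∀ i, NormedAddCommGroup (X i)] [∀ i, NormedSpace 𝕂 (X i)]
    {Y : Type*} [NormedAddCommGroup Y] [NormedSpace 𝕂 Y]
    (f : ContinuousMultilinearMap 𝕂 X Y) {x : ∀ i, X i} (hx : ∀ i, ‖x i‖ = 1) :
    ‖f x‖ ≤ ‖f‖ := by
  simpa [hx] using f.le_opNorm x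

/-- If an `(N+1)`-linear map `A` has the Bhatia--Šemrl property, then so does the associated
operator `T_A = A.curryLeft : E 0 → L^N(E 1, …, E N; Y)`. -/
theorem BS_operator_of_BS_multilinear {𝕂 : Type*} [RCLike 𝕂] {N : ℕ}
    {E : Fin (N + 1) → Type*}
    [∀ i, NormedAddCommGroup (E i)] [∀ i, NormedSpace 𝕂 (E i)] [∀ i, CompleteSpace (E i)]
    {Y : Type*} [NormedAddCommGroup Y] [NormedSpace 𝕂 Y] [CompleteSpace Y]
    (A : ContinuousMultilinearMap 𝕂 E Y) (hA : HasBSPropMulti 𝕂 A) :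
    HasBSProp 𝕂 A.curryLeft := by
  intro S hS
  have hAB : BJOrth 𝕂 A S.uncurryLeft := fun a => by
    have h : (A + a • S.uncurryLeft).curryLeft = A.curryLeft + a • S := by
      ext x m
      simp
    simpa only [← h, ContinuousMultilinearMap.curryLeft_norm] using hS a
  obtain ⟨x, hx, hAx, hBx⟩ := hA _ hAB
  have hT : ‖A.curryLeft (x 0)‖ ≤ ‖A x‖ := by
    simpa [hx, hAx] using A.curryLeft.le_opNorm (x 0)
  have htail : ∀ i, ‖Fin.tail x i‖ = 1 := fun i => hx i.succ
  refine ⟨x 0, hx 0, le_antisymm ?_ ?_, fun a => hT.trans ((hBx a).trans ?_)⟩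
  · simpa [hAx] using hT
  · simpa [← hAx] using (A.curryLeft (x 0)).norm_apply_le_of_norm_eq_one htail
  · simpa using (A.curryLeft (x 0) + a • S (x 0)).norm_apply_le_of_norm_eq_one htail
end
end

section
/- Let Y be any Banach space over 𝕂 = ℝ or ℂ. Then the only compact operator from c₀ to Y with the Bhatia–Šemrl property is the zero operator, i.e., BS(c₀;Y) ∩ K(c₀;Y) = {0}. -/
noncomputable section

open scoped ZeroAtInfty

open Filter Topology

section SequenceSpace

variable {𝕂 : Type*} [RCLike 𝕂]

theorem c0_norm_le_iff {x : C₀(ℕ, 𝕂)} {C : ℝ} (hC : 0 ≤ C) : ‖x‖ ≤ C ↔ ∀ n, ‖x n‖ ≤ C := by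
  rw [← ZeroAtInftyContinuousMap.norm_toBCF_eq_norm, BoundedContinuousFunction.norm_le hC]
  rfl

theorem c0_norm_apply_le_s14 (x : C₀(ℕ, 𝕂)) (n : ℕ) : ‖x n‖ ≤ ‖x‖ :=
  (c0_norm_le_iff (norm_nonneg x)).1 le_rfl n

theorem c0_tendsto_atTop (x : C₀(ℕ, 𝕂)) : Tendsto x atTop (𝓝 0) := by
  rw [← Nat.cofinite_eq_atTop, ← cocompact_eq_cofinite]
  exact x.zero_at_infty'

/-- The sequence `x` with its first `N` entries replaced by those of `g`. -/
def c0Replace (x : C₀(ℕ, 𝕂)) (g : ℕ → 𝕂) (N : ℕ) : C₀(ℕ, 𝕂) where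
  toFun n := if n < N then g n else x n
  continuous_toFun := continuous_of_discreteTopology
  zero_at_infty' := by
    rw [cocompact_eq_cofinite, Nat.cofinite_eq_atTop]
    refine (c0_tendsto_atTop x).congr' ?_
    filter_upwards [eventually_ge_atTop N] with n hn
    simp [hn.not_gt]

theorem c0Replace_apply (x : C₀(ℕ, 𝕂)) (g : ℕ → 𝕂) (N n : ℕ) :
    c0Replace x g N n = if n < N then g n else x n := rfl

/-- A functional attaining its norm at `x` ignores the coordinates where `‖x n‖ < 1`. -/
theorem apply_eq_of_eq_off {M : ℝ} (φ : StrongDual 𝕂 C₀(ℕ, 𝕂)) (hφ : ‖φ‖ ≤ M)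
    {x y : C₀(ℕ, 𝕂)} (hx : ‖x‖ ≤ 1) (hφx : φ x = (M : 𝕂)) {n : ℕ} (hn : ‖x n‖ < 1)
    (hy : ∀ k, k ≠ n → y k = x k) : φ y = φ x := by
  have hM : 0 ≤ M := (norm_nonneg φ).trans hφ
  by_contra hne
  set c : 𝕂 := φ (y - x) with hc
  have hc0 : c ≠ 0 := by rw [hc, map_sub]; exact sub_ne_zero.2 hne
  have hcn : 0 < ‖c‖ := norm_pos_iff.2 hc0
  set D : ℝ := ‖c‖ * ‖y n - x n‖ + 1 with hD
  have hDpos : 0 < D := by positivity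
  set t : ℝ := (1 - ‖x n‖) / D with ht
  have htpos : 0 < t := div_pos (by linarith) hDpos
  have htD : t * D = 1 - ‖x n‖ := div_mul_cancel₀ _ hDpos.ne'
  have hnorm : ‖x + ((t : 𝕂) * starRingEnd 𝕂 c) • (y - x)‖ ≤ 1 := by
    refine (c0_norm_le_iff zero_le_one).2 fun k => ?_
    simp only [ZeroAtInftyContinuousMap.add_apply, ZeroAtInftyContinuousMap.smul_apply,
      ZeroAtInftyContinuousMap.sub_apply]
    by_cases hk : k = n
    · subst hk
      refine (norm_add_le _ _).trans ?_
      rw [norm_smul, norm_mul, RCLike.norm_conj, RCLike.norm_ofReal, abs_of_pos htpos]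
      nlinarith
    · rw [hy k hk]
      simpa using (c0_norm_apply_le_s14 x k).trans hx
  have hval : φ (x + ((t : 𝕂) * starRingEnd 𝕂 c) • (y - x)) = ((M + t * ‖c‖ ^ 2 : ℝ) : 𝕂) := by
    rw [map_add, map_smul, ← hc, hφx, smul_eq_mul, mul_assoc, RCLike.conj_mul]
    push_cast
    rfl
  have hle := (φ.le_opNorm_of_le hnorm).trans (by simpa using hφ)
  rw [hval, RCLike.norm_ofReal] at hle
  have : 0 < t * ‖c‖ ^ 2 := by positivity
  linarith [le_abs_self (M + t * ‖c‖ ^ 2)]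

theorem norm_c0Replace_le {x : C₀(ℕ, 𝕂)} {g : ℕ → 𝕂} (hx : ‖x‖ ≤ 1) (hg : ∀ n, ‖g n‖ = 1)
    (N : ℕ) : ‖c0Replace x g N‖ ≤ 1 := by
  refine (c0_norm_le_iff zero_le_one).2 fun k => ?_
  rw [c0Replace_apply]
  split_ifs
  · exact (hg k).le
  · exact (c0_norm_apply_le_s14 x k).trans hx

theorem apply_c0Replace {M : ℝ} (φ : StrongDual 𝕂 C₀(ℕ, 𝕂)) (hφ : ‖φ‖ ≤ M)
    {x : C₀(ℕ, 𝕂)} {g : ℕ → 𝕂} (hx : ‖x‖ ≤ 1) (hφx : φ x = (M : 𝕂)) (hg : ∀ n, ‖g n‖ = 1)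
    (hgx : ∀ n, ‖x n‖ = 1 → g n = x n) (N : ℕ) : φ (c0Replace x g N) = (M : 𝕂) := by
  induction N with
  | zero =>
    convert hφx using 2
    ext n
    simp [c0Replace_apply]
  | succ N ih =>
    have hoff : ∀ k, k ≠ N → c0Replace x g (N + 1) k = c0Replace x g N k := fun k hk => by
      rw [c0Replace_apply, c0Replace_apply]
      have : k < N + 1 ↔ k < N := by omega
      simp only [this]
    have hN : c0Replace x g N N = x N := by simp [c0Replace_apply]
    rcases ((c0_norm_apply_le_s14 x N).trans hx).lt_or_eq with h | h
    · rw [apply_eq_of_eq_off φ hφ (norm_c0Replace_le hx hg N) ih (by rwa [hN]) hoff, ih]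
    · rw [← ih]
      congr 1
      ext k
      by_cases hk : k = N
      · subst hk
        rw [hN, ← hgx k h]
        simp [c0Replace_apply]
      · exact hoff k hk

theorem summable_half_pow : Summable fun n : ℕ => (1 : ℝ) / 2 / 2 ^ n :=
  (hasSum_geometric_two' 1).summable

theorem norm_weight_mul {g : ℕ → 𝕂} (hg : ∀ n, ‖g n‖ = 1) (z : 𝕂) (n : ℕ) :
    ‖((1 / 2 / 2 ^ n : ℝ) : 𝕂) * starRingEnd 𝕂 (g n) * z‖ = 1 / 2 / 2 ^ n * ‖z‖ := by
  rw [norm_mul, norm_mul, RCLike.norm_conj, hg, RCLike.norm_ofReal, abs_of_pos (by positivity),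
    mul_one]

theorem summable_weight_mul {g : ℕ → 𝕂} (hg : ∀ n, ‖g n‖ = 1) (x : C₀(ℕ, 𝕂)) :
    Summable fun n => ‖((1 / 2 / 2 ^ n : ℝ) : 𝕂) * starRingEnd 𝕂 (g n) * x n‖ := by
  simp only [norm_weight_mul hg]
  refine Summable.of_nonneg_of_le (fun n => by positivity) (fun n => ?_)
    (summable_half_pow.mul_right ‖x‖)
  exact mul_le_mul_of_nonneg_left (c0_norm_apply_le_s14 x n) (by positivity)

/-- The functional `x ↦ ∑ 2⁻ⁿ⁻¹ conj (g n) x n` for a unimodular sequence `g`. -/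
def weightedFunctional (g : ℕ → 𝕂) (hg : ∀ n, ‖g n‖ = 1) : StrongDual 𝕂 C₀(ℕ, 𝕂) :=
  LinearMap.mkContinuous
    { toFun := fun x => ∑' n, ((1 / 2 / 2 ^ n : ℝ) : 𝕂) * starRingEnd 𝕂 (g n) * x n
      map_add' := fun x y => by
        rw [← (summable_weight_mul hg x).of_norm.tsum_add (summable_weight_mul hg y).of_norm]
        simp only [ZeroAtInftyContinuousMap.add_apply, mul_add]
      map_smul' := fun a x => by
        rw [RingHom.id_apply, smul_eq_mul, ← tsum_mul_left]
        congr 1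
        ext n
        rw [ZeroAtInftyContinuousMap.smul_apply, smul_eq_mul]
        ring }
    1 fun x => by
      refine tsum_of_norm_bounded ((hasSum_geometric_two' 1).mul_right ‖x‖) fun n => ?_
      rw [norm_weight_mul hg]
      exact mul_le_mul_of_nonneg_left (c0_norm_apply_le_s14 x n) (by positivity)

theorem weightedFunctional_apply (g : ℕ → 𝕂) (hg : ∀ n, ‖g n‖ = 1) (x : C₀(ℕ, 𝕂)) :
    weightedFunctional g hg x =
      ∑' n, ((1 / 2 / 2 ^ n : ℝ) : 𝕂) * starRingEnd 𝕂 (g n) * x n := rfl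

theorem norm_weightedFunctional_lt (g : ℕ → 𝕂) (hg : ∀ n, ‖g n‖ = 1) {x : C₀(ℕ, 𝕂)}
    (hx : ‖x‖ ≤ 1) : ‖weightedFunctional g hg x‖ < 1 := by
  obtain ⟨n, hn⟩ := ((c0_tendsto_atTop x).norm.eventually_lt_const
    (by simp : ‖(0 : 𝕂)‖ < 1)).exists
  rw [weightedFunctional_apply]
  refine (norm_tsum_le_tsum_norm (summable_weight_mul hg x)).trans_lt ?_
  refine lt_of_lt_of_eq ?_ (tsum_geometric_two' 1)
  refine Summable.tsum_lt_tsum (i := n) (fun k => ?_) ?_ (summable_weight_mul hg x)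
    summable_half_pow
  · rw [norm_weight_mul hg]
    exact mul_le_of_le_one_right (by positivity) ((c0_norm_apply_le_s14 x k).trans hx)
  · rw [norm_weight_mul hg]
    exact mul_lt_of_lt_one_right (by positivity) hn

theorem tendsto_weightedFunctional_c0Replace (g : ℕ → 𝕂) (hg : ∀ n, ‖g n‖ = 1)
    {x : C₀(ℕ, 𝕂)} (hx : ‖x‖ ≤ 1) :
    Tendsto (fun N => weightedFunctional g hg (c0Replace x g N)) atTop (𝓝 1) := by
  have hsum : ∑' n, ((1 / 2 / 2 ^ n : ℝ) : 𝕂) * starRingEnd 𝕂 (g n) * g n = 1 := by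
    simp only [mul_assoc, RCLike.conj_mul, hg, RCLike.ofReal_one, one_pow, mul_one]
    rw [← RCLike.ofReal_tsum, tsum_geometric_two', RCLike.ofReal_one]
  rw [← hsum]
  simp only [weightedFunctional_apply]
  refine tendsto_tsum_of_dominated_convergence summable_half_pow (fun n => ?_)
    (Eventually.of_forall fun N n => ?_)
  · refine tendsto_const_nhds.congr' ?_
    filter_upwards [eventually_gt_atTop n] with N hN
    simp [c0Replace_apply, hN]
  · rw [norm_weight_mul hg]
    exact mul_le_of_le_one_right (by positivity)
      ((c0_norm_apply_le_s14 _ n).trans (norm_c0Replace_le hx hg N))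

/-- Compactness is not needed: no nonzero operator on `c₀` has the Bhatia--Šemrl property. -/
theorem HasBSProp.eq_zero {Y : Type*} [NormedAddCommGroup Y] [NormedSpace 𝕂 Y]
    {T : C₀(ℕ, 𝕂) →L[𝕂] Y} (hT : HasBSProp 𝕂 T) : T = 0 := by
  by_contra hne
  have hM : 0 < ‖T‖ :=
    (ContinuousLinearMap.opNorm_nonneg T).lt_of_ne' (mt (ContinuousLinearMap.opNorm_zero_iff T).1 hne)
  obtain ⟨x, hx, hTx, -⟩ := hT 0 fun a => by simp
  obtain ⟨f, hf, hfx⟩ := exists_dual_vector'' 𝕂 (T x)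
  rw [hTx] at hfx
  set g : ℕ → 𝕂 := fun n => if ‖x n‖ = 1 then x n else 1 with hgdef
  have hg : ∀ n, ‖g n‖ = 1 := fun n => by
    simp only [hgdef]
    split_ifs with h
    · exact h
    · exact norm_one
  have hgx : ∀ n, ‖x n‖ = 1 → g n = x n := fun n h => by simp [hgdef, h]
  have hφ : ‖f.comp T‖ ≤ ‖T‖ :=
    (f.opNorm_comp_le T).trans (mul_le_of_le_one_left (norm_nonneg _) hf)
  have happ := apply_c0Replace (f.comp T) hφ hx.le hfx hg hgx
  set ψ := weightedFunctional g hg with hψ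
  obtain ⟨z, hz, hTz, horth⟩ := hT (T - ψ.smulRight (T x)) fun a => by
    have hlim : Tendsto (fun N => f ((T + a • (T - ψ.smulRight (T x))) (c0Replace x g N)))
        atTop (𝓝 (‖T‖ : 𝕂)) := by
      have h := ((tendsto_weightedFunctional_c0Replace g hg hx.le).const_sub 1).const_mul
        (a * (‖T‖ : 𝕂)) |>.const_add (‖T‖ : 𝕂)
      simp only [sub_self, mul_zero, add_zero] at h
      refine h.congr fun N => ?_
      have h1 : f (T (c0Replace x g N)) = (‖T‖ : 𝕂) := happ N
      simp only [add_apply, smul_apply,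
        sub_apply, ContinuousLinearMap.smulRight_apply, map_add, map_smul,
        map_sub, smul_eq_mul, h1, hfx, hψ]
      ring
    have hn := hlim.norm
    rw [RCLike.norm_ofReal, abs_of_pos hM] at hn
    refine le_of_tendsto hn (Eventually.of_forall fun N => ?_)
    refine (f.le_of_opNorm_le hf _).trans ?_
    rw [one_mul]
    exact ContinuousLinearMap.unit_le_opNorm _ _ (norm_c0Replace_le hx.le hg N)
  have hlt : ‖ψ z‖ < 1 := norm_weightedFunctional_lt g hg hz.le
  have h := horth (-(1 / 2))
  have hrw : T z + (-(1 / 2) : 𝕂) • (T - ψ.smulRight (T x)) z =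
      (1 / 2 : 𝕂) • (T z + ψ z • T x) := by
    simp only [sub_apply, ContinuousLinearMap.smulRight_apply]
    module
  have hhalf : ‖(1 / 2 : 𝕂)‖ = 1 / 2 := by simp
  rw [hrw, norm_smul, hhalf] at h
  have h2 := norm_add_le (T z) (ψ z • T x)
  rw [norm_smul, hTx, hTz] at h2
  rw [hTz] at h
  nlinarith

theorem hasBSProp_zero {Y : Type*} [NormedAddCommGroup Y] [NormedSpace 𝕂 Y] :
    HasBSProp 𝕂 (0 : C₀(ℕ, 𝕂) →L[𝕂] Y) := by
  intro S _
  have hle : ‖c0Replace (0 : C₀(ℕ, 𝕂)) 1 1‖ ≤ 1 := norm_c0Replace_le (by simp) (by simp) 1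
  refine ⟨c0Replace 0 1 1, le_antisymm hle ?_, by simp, fun a => by simp⟩
  simpa [c0Replace_apply] using c0_norm_apply_le_s14 (c0Replace (0 : C₀(ℕ, 𝕂)) 1 1) 0

end SequenceSpace

open scoped ZeroAtInfty in
/-- The zero operator is the only compact operator from `c₀` to `Y` with the
Bhatia--Šemrl property. -/
theorem BS_inter_compact_eq_zero {𝕂 Y : Type*} [RCLike 𝕂]
    [NormedAddCommGroup Y] [NormedSpace 𝕂 Y] [CompleteSpace Y] :
    {T : C₀(ℕ, 𝕂) →L[𝕂] Y | HasBSProp 𝕂 T ∧ IsCompactOperator ⇑T} = {0} := by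
  ext T
  refine ⟨fun h => h.1.eq_zero, ?_⟩
  rintro rfl
  exact ⟨hasBSProp_zero, isCompactOperator_zero⟩
end
end
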